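/- After Matchday 4, under the head-to-head tiebreak, a team D is certain to finish fourth if and only if either (i) the current points of every other team exceed the current points of D by at least 7, or (ii) there is a team C such that C's current points exceed D's current points by exactly 6, the current points of every team other than C and D exceed D's current points by at least 7, and both ordered matches between C and D belong to P (D has already played two matches against C). -/

import Mathlib

/-- Teams are the elements of `Fin 4`. -/
abbrev Team : Type := Fin 4

/-- A complete tournament assigns to each ordered pair `(i, j)` (with `i` at home)
a result `(goals scored by i, goals scored by j)`.  Only values at pairs of
distinct teams are meaningful. -/
abbrev Tournament : Type := Team → Team → ℕ × ℕ

/-- Points obtained in a single match by a team scoring `g` goals and conceding `c`. -/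
def matchPts (g c : ℕ) : ℕ := if c < g then 3 else if g = c then 1 else 0

/-- The set of all 12 ordered matches. -/
def allMatches : Finset (Team × Team) := Finset.univ.filter (fun m => m.1 ≠ m.2)

/-- Points of team `i` summed over the matches in `P` (the played matches). -/
def currentPts (P : Finset (Team × Team)) (T : Tournament) (i : Team) : ℕ :=
  ∑ m ∈ P,
    (if m.1 = i then matchPts (T m.1 m.2).1 (T m.1 m.2).2
     else if m.2 = i then matchPts (T m.1 m.2).2 (T m.1 m.2).1
     else 0)

/-- Total points of team `i` in a complete tournament. -/
def totalPts (T : Tournament) (i : Team) : ℕ := currentPts allMatches T i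

/-- Goal difference of team `i` in a complete tournament. -/
def goalDiff (T : Tournament) (i : Team) : ℤ :=
  ∑ m ∈ allMatches,
    (if m.1 = i then ((T m.1 m.2).1 : ℤ) - ((T m.1 m.2).2 : ℤ)
     else if m.2 = i then ((T m.1 m.2).2 : ℤ) - ((T m.1 m.2).1 : ℤ)
     else 0)

/-- Points obtained by team `i` in its two mutual matches against team `j`. -/
def mutualPts (T : Tournament) (i j : Team) : ℕ :=
  matchPts (T i j).1 (T i j).2 + matchPts (T j i).2 (T j i).1

/-- Goal difference of team `i` in its two mutual matches against team `j`. -/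
def mutualGD (T : Tournament) (i j : Team) : ℤ :=
  (((T i j).1 : ℤ) - ((T i j).2 : ℤ)) + (((T j i).2 : ℤ) - ((T j i).1 : ℤ))

/-- Goal-difference tiebreak: `i` is ranked strictly above `j`. -/
def RankedAboveGD (T : Tournament) (i j : Team) : Prop :=
  totalPts T j < totalPts T i ∨
    (totalPts T i = totalPts T j ∧ goalDiff T j < goalDiff T i)

/-- Head-to-head tiebreak: `i` is ranked strictly above `j`. -/
def RankedAboveH2H (T : Tournament) (i j : Team) : Prop :=
  totalPts T j < totalPts T i ∨
    (totalPts T i = totalPts T j ∧ mutualPts T j i < mutualPts T i j) ∨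
    (totalPts T i = totalPts T j ∧ mutualPts T i j = mutualPts T j i ∧
      mutualGD T j i < mutualGD T i j)

open Classical in
/-- Final position of team `i` under the goal-difference tiebreak. -/
noncomputable def finalPosGD (T : Tournament) (i : Team) : ℕ :=
  1 + (Finset.univ.filter (fun j => RankedAboveGD T j i)).card

open Classical in
/-- Final position of team `i` under the head-to-head tiebreak. -/
noncomputable def finalPosH2H (T : Tournament) (i : Team) : ℕ :=
  1 + (Finset.univ.filter (fun j => RankedAboveH2H T j i)).card

/-- `T'` is a completion of the partial tournament `(P, T)`. -/
def Completes (P : Finset (Team × Team)) (T T' : Tournament) : Prop :=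
  ∀ m ∈ P, T' m.1 m.2 = T m.1 m.2

/-- The set `P` of played matches corresponds to the situation after Matchday 4:
every unordered pair of distinct teams has at least one of its ordered matches
played, and exactly two unordered pairs — which are disjoint, forming a perfect
matching of the four teams — have both of their ordered matches played. -/
def AfterMD4 (P : Finset (Team × Team)) : Prop :=
  (∀ m ∈ P, m.1 ≠ m.2) ∧
  (∀ i j : Team, i ≠ j → (i, j) ∈ P ∨ (j, i) ∈ P) ∧
  ∃ a b c d : Team,
    ({a, b, c, d} : Finset Team) = Finset.univ ∧
    (a, b) ∈ P ∧ (b, a) ∈ P ∧ (c, d) ∈ P ∧ (d, c) ∈ P ∧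
    ∀ i j : Team, (i, j) ∈ P → (j, i) ∈ P →
      ({i, j} : Finset Team) = {a, b} ∨ ({i, j} : Finset Team) = {c, d}

/-- Points obtained by team `i` in those of its two matches against `j` that belong to `P`. -/
def pairPts (P : Finset (Team × Team)) (T : Tournament) (i j : Team) : ℕ :=
  (if (i, j) ∈ P then matchPts (T i j).1 (T i j).2 else 0) +
    (if (j, i) ∈ P then matchPts (T j i).2 (T j i).1 else 0)

lemma matchPts_le (g c : ℕ) : matchPts g c ≤ 3 := by
  unfold matchPts; split_ifs <;> omega

lemma matchPts_add_le (g c : ℕ) : matchPts g c + matchPts c g ≤ 3 := by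
  unfold matchPts; split_ifs <;> omega

lemma matchPts_of_lt {g c : ℕ} (h : c < g) : matchPts g c = 3 := by
  simp [matchPts, h]

lemma matchPts_of_gt {g c : ℕ} (h : g < c) : matchPts g c = 0 := by
  unfold matchPts; split_ifs <;> omega

lemma le_matchPts_of_matchPts_le_one {g c : ℕ} (h : matchPts g c ≤ 1) :
    3 ≤ matchPts c g + 2 * matchPts g c := by
  unfold matchPts at *; split_ifs at * <;> omega

lemma mem_allMatches {i j : Team} : (i, j) ∈ allMatches ↔ i ≠ j := by
  simp [allMatches]

lemma currentPts_eq_sum_pairPts {P : Finset (Team × Team)} (hP : ∀ m ∈ P, m.1 ≠ m.2)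
    (T : Tournament) (i : Team) : currentPts P T i = ∑ j, pairPts P T i j := by
  have hd : ∀ k, (k, k) ∉ P := fun k hk => hP _ hk rfl
  have hsum : currentPts P T i = ∑ a, ∑ b, if (a, b) ∈ P then
      (if a = i then matchPts (T a b).1 (T a b).2
        else if b = i then matchPts (T a b).2 (T a b).1 else 0) else 0 := by
    rw [← Fintype.sum_prod_type', currentPts, ← Finset.sum_filter]
    simp
  rw [hsum]
  simp only [Fin.sum_univ_four, pairPts]
  fin_cases i <;> simp [hd] <;> omega

lemma totalPts_eq_sum_pairPts (T : Tournament) (i : Team) :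
    totalPts T i = ∑ j, pairPts allMatches T i j :=
  currentPts_eq_sum_pairPts (by simp [allMatches]) T i

lemma mutualPts_eq_pairPts {P : Finset (Team × Team)} {T : Tournament} {i j : Team}
    (hij : (i, j) ∈ P) (hji : (j, i) ∈ P) : mutualPts T i j = pairPts P T i j := by
  simp [mutualPts, pairPts, hij, hji]

lemma pairPts_add_le (P : Finset (Team × Team)) (T : Tournament) (i j : Team) :
    pairPts P T i j + pairPts P T j i ≤ 6 := by
  have h₁ := matchPts_add_le (T i j).1 (T i j).2
  have h₂ := matchPts_add_le (T j i).1 (T j i).2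
  unfold pairPts; split_ifs <;> omega

lemma pairPts_add_le_three {P : Finset (Team × Team)} (T : Tournament) {i j : Team}
    (h : ¬((i, j) ∈ P ∧ (j, i) ∈ P)) : pairPts P T i j + pairPts P T j i ≤ 3 := by
  have h₁ := matchPts_add_le (T i j).1 (T i j).2
  have h₂ := matchPts_add_le (T j i).1 (T j i).2
  unfold pairPts; split_ifs <;> first | omega | tauto

section Completion

variable {P : Finset (Team × Team)} {T T' : Tournament} {i j : Team}

lemma pairPts_le_of_completes (h : Completes P T T') (hij : i ≠ j) :
    pairPts P T i j ≤ pairPts allMatches T' i j := by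
  have h₁ := h (i, j)
  have h₂ := h (j, i)
  simp only [pairPts, mem_allMatches, hij, hij.symm, ne_eq, not_false_eq_true, if_true] at *
  split_ifs <;> simp_all

lemma pairPts_eq_of_completes (h : Completes P T T') (hij : i ≠ j)
    (h₁ : (i, j) ∈ P) (h₂ : (j, i) ∈ P) : pairPts allMatches T' i j = pairPts P T i j := by
  have e₁ := h _ h₁
  have e₂ := h _ h₂
  simp_all [pairPts, mem_allMatches, hij.symm]

lemma pairPts_le_add_three_of_completes (h : Completes P T T') (hij : i ≠ j)
    (hp : (i, j) ∈ P ∨ (j, i) ∈ P) :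
    pairPts allMatches T' i j ≤ pairPts P T i j + 3 := by
  have h₁ := h (i, j)
  have h₂ := h (j, i)
  have b₁ := matchPts_le (T' i j).1 (T' i j).2
  have b₂ := matchPts_le (T' j i).2 (T' j i).1
  simp only [pairPts, mem_allMatches, hij, hij.symm, ne_eq, not_false_eq_true, if_true] at *
  split_ifs <;> simp_all; omega

end Completion

/-- The team `C` met twice by `D`, and the two other teams. -/
lemma AfterMD4.exists_partner {P : Finset (Team × Team)} (hP : AfterMD4 P) (D : Team) :
    ∃ C A B : Team, (C ≠ D ∧ A ≠ D ∧ B ≠ D ∧ A ≠ C ∧ B ≠ C ∧ A ≠ B) ∧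
      (C, D) ∈ P ∧ (D, C) ∈ P ∧
      ¬((D, A) ∈ P ∧ (A, D) ∈ P) ∧ ¬((D, B) ∈ P ∧ (B, D) ∈ P) ∧
      ¬((C, A) ∈ P ∧ (A, C) ∈ P) ∧ ¬((C, B) ∈ P ∧ (B, C) ∈ P) := by
  obtain ⟨-, -, a, b, c, d, hu, hab, hba, hcd, hdc, hex⟩ := hP
  have hne : a ≠ b ∧ a ≠ c ∧ a ≠ d ∧ b ≠ c ∧ b ≠ d ∧ c ≠ d := by
    clear hab hba hcd hdc hex; revert a b c d; decide
  have cross : ∀ i j : Team, (i = a ∨ i = b) → (j = c ∨ j = d) →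
      ¬((i, j) ∈ P ∧ (j, i) ∈ P) := by
    rintro i j hi hj ⟨h₁, h₂⟩
    obtain ⟨n₁, n₂, n₃, n₄, n₅, n₆⟩ := hne
    rcases hex i j h₁ h₂ with h | h
    · have e : j ∈ ({a, b} : Finset Team) := h ▸ by simp
      simp only [Finset.mem_insert, Finset.mem_singleton] at e
      grind
    · have e : i ∈ ({c, d} : Finset Team) := h ▸ by simp
      simp only [Finset.mem_insert, Finset.mem_singleton] at e
      grind
  have hD : D ∈ ({a, b, c, d} : Finset Team) := hu ▸ Finset.mem_univ D
  simp only [Finset.mem_insert, Finset.mem_singleton] at hD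
  have cac := cross a c (.inl rfl) (.inl rfl)
  have cad := cross a d (.inl rfl) (.inr rfl)
  have cbc := cross b c (.inr rfl) (.inl rfl)
  have cbd := cross b d (.inr rfl) (.inr rfl)
  obtain ⟨n₁, n₂, n₃, n₄, n₅, n₆⟩ := hne
  rcases hD with rfl | rfl | rfl | rfl
  · exact ⟨b, c, d, ⟨n₁.symm, n₂.symm, n₃.symm, n₄.symm, n₅.symm, n₆⟩,
      hba, hab, cac, cad, cbc, cbd⟩
  · exact ⟨a, c, d, ⟨n₁, n₄.symm, n₅.symm, n₂.symm, n₃.symm, n₆⟩,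
      hab, hba, cbc, cbd, cac, cad⟩
  · exact ⟨d, a, b, ⟨n₆.symm, n₂, n₄, n₃, n₅, n₁⟩, hdc, hcd,
      fun h => cac h.symm, fun h => cbc h.symm, fun h => cad h.symm, fun h => cbd h.symm⟩
  · exact ⟨c, a, b, ⟨n₆, n₃, n₅, n₂, n₄, n₁⟩, hcd, hdc,
      fun h => cad h.symm, fun h => cbd h.symm, fun h => cac h.symm, fun h => cbc h.symm⟩

lemma sum_team_eq {a b c d : Team}
    (h : b ≠ a ∧ c ≠ a ∧ d ≠ a ∧ c ≠ b ∧ d ≠ b ∧ c ≠ d) (f : Team → ℕ) :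
    ∑ j, f j = f a + f b + f c + f d := by
  have hu : (Finset.univ : Finset Team) = {a, b, c, d} := by
    revert a b c d; decide
  obtain ⟨h₁, h₂, h₃, h₄, h₅, h₆⟩ := h
  rw [hu, Finset.sum_insert (by simp; tauto), Finset.sum_insert (by simp; tauto),
    Finset.sum_pair h₆]
  ring

/-- The completion in which `D` wins its remaining matches with `K` goals against none, and `j`
loses its remaining matches. -/
def worstCompletion (P : Finset (Team × Team)) (T : Tournament) (D j : Team) (K : ℕ) :
    Tournament := fun a b =>
  if (a, b) ∈ P then T a b else if a = D then (K, 0) else if b = D then (0, K)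
  else if a = j then (0, 1) else (1, 0)

lemma completes_worstCompletion (P : Finset (Team × Team)) (T : Tournament) (D j : Team)
    (K : ℕ) : Completes P T (worstCompletion P T D j K) := by
  intro m hm
  simp [worstCompletion, hm]

lemma pairPts_self {P : Finset (Team × Team)} (hP : ∀ m ∈ P, m.1 ≠ m.2) (T : Tournament)
    (i : Team) : pairPts P T i i = 0 := by
  have : (i, i) ∉ P := fun h => hP _ h rfl
  simp [pairPts, this]

lemma totalPts_worstCompletion_loser {P : Finset (Team × Team)} (hP : ∀ m ∈ P, m.1 ≠ m.2)
    (T : Tournament) {D j : Team} (hj : j ≠ D) {K : ℕ} (hK : 0 < K) :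
    totalPts (worstCompletion P T D j K) j = currentPts P T j := by
  rw [totalPts_eq_sum_pairPts, currentPts_eq_sum_pairPts hP]
  refine Finset.sum_congr rfl fun k _ => ?_
  by_cases hk : j = k
  · subst hk
    rw [pairPts_self hP, pairPts_self (by simp [allMatches])]
  · have h₀ := matchPts_of_gt hK
    have h₁ : matchPts 0 1 = 0 := rfl
    simp only [pairPts, mem_allMatches, worstCompletion, ne_eq, hk, Ne.symm hk,
      not_false_eq_true, if_true]
    split_ifs <;> simp_all

lemma pairPts_worstCompletion_winner {P : Finset (Team × Team)} (T : Tournament)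
    {D j k : Team} (hk : k ≠ D) {K : ℕ} (hK : 0 < K)
    (hP : ¬((D, k) ∈ P ∧ (k, D) ∈ P)) :
    pairPts P T D k + 3 ≤ pairPts allMatches (worstCompletion P T D j K) D k := by
  have h₀ := matchPts_of_lt hK
  simp only [pairPts, mem_allMatches, worstCompletion, ne_eq, hk, hk.symm,
    not_false_eq_true, if_true]
  split_ifs <;> simp_all [add_comm]

lemma AfterMD4.totalPts_worstCompletion_winner {P : Finset (Team × Team)} (hP : AfterMD4 P)
    (T : Tournament) {D j : Team} {K : ℕ} (hK : 0 < K) :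
    currentPts P T D + 6 ≤ totalPts (worstCompletion P T D j K) D := by
  obtain ⟨C, A, B, hne, hCD, hDC, hA, hB, -, -⟩ := hP.exists_partner D
  rw [totalPts_eq_sum_pairPts, currentPts_eq_sum_pairPts hP.1, sum_team_eq hne,
    sum_team_eq hne, pairPts_self hP.1]
  have h₁ := pairPts_le_of_completes (completes_worstCompletion P T D j K) hne.1.symm
  have h₂ := pairPts_worstCompletion_winner (j := j) T hne.2.1 hK hA
  have h₃ := pairPts_worstCompletion_winner (j := j) T hne.2.2.1 hK hB
  omega

/-- A team sure to be ranked above `D` leads it by at least seven points, or by exactly six if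
the two teams have no match left to play against each other. -/
lemma AfterMD4.lead_of_certain {P : Finset (Team × Team)} {T : Tournament} (hP : AfterMD4 P)
    {D j : Team} (hj : j ≠ D)
    (h : ∀ T' : Tournament, Completes P T T' → RankedAboveH2H T' j D) :
    currentPts P T D + 7 ≤ currentPts P T j ∨
      (currentPts P T j = currentPts P T D + 6 ∧ (j, D) ∈ P ∧ (D, j) ∈ P) := by
  obtain ⟨K, hK⟩ : ∃ K, K = 1 + (T D j).2 + (T j D).1 := ⟨_, rfl⟩
  have hK₀ : 0 < K := by omega
  have hr := h _ (completes_worstCompletion P T D j K)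
  have hl := totalPts_worstCompletion_loser hP.1 T hj hK₀
  have hw := hP.totalPts_worstCompletion_winner T (D := D) (j := j) hK₀
  by_cases hb : (j, D) ∈ P ∧ (D, j) ∈ P
  · rcases hr with hr | hr | hr
    all_goals
      have : currentPts P T D + 6 ≤ currentPts P T j := by omega
      rcases this.eq_or_lt with h | h
      · exact .inr ⟨h.symm, hb⟩
      · exact .inl h
  · left
    rcases hr with hr | ⟨-, hr⟩ | ⟨-, -, hr⟩
    · omega
    · exfalso
      have b₁ := matchPts_le (T j D).1 (T j D).2
      have b₂ := matchPts_le (T D j).2 (T D j).1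
      have h₀ := matchPts_of_lt hK₀
      have h₁ := matchPts_of_gt hK₀
      have hp := hP.2.1 j D hj
      simp only [mutualPts, worstCompletion, hj] at hr
      split_ifs at hr <;> simp_all <;> omega
    · exfalso
      have hp := hP.2.1 j D hj
      simp only [mutualGD, worstCompletion, hj] at hr
      split_ifs at hr <;> simp_all <;> omega

lemma AfterMD4.totalPts_le {P : Finset (Team × Team)} (hP : AfterMD4 P) {T T' : Tournament}
    (h : Completes P T T') (D : Team) : totalPts T' D ≤ currentPts P T D + 6 := by
  obtain ⟨C, A, B, hne, hCD, hDC, -⟩ := hP.exists_partner D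
  rw [totalPts_eq_sum_pairPts, currentPts_eq_sum_pairPts hP.1, sum_team_eq hne,
    sum_team_eq hne, pairPts_self hP.1, pairPts_self (by simp [allMatches])]
  have h₁ := pairPts_eq_of_completes h hne.1.symm hDC hCD
  have h₂ := pairPts_le_add_three_of_completes h hne.2.1.symm (hP.2.1 D A hne.2.1.symm)
  have h₃ := pairPts_le_add_three_of_completes h hne.2.2.1.symm (hP.2.1 D B hne.2.2.1.symm)
  omega

lemma currentPts_le_totalPts {P : Finset (Team × Team)} (hP : ∀ m ∈ P, m.1 ≠ m.2)
    {T T' : Tournament} (h : Completes P T T') (i : Team) :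
    currentPts P T i ≤ totalPts T' i := by
  rw [totalPts_eq_sum_pairPts, currentPts_eq_sum_pairPts hP]
  refine Finset.sum_le_sum fun k _ => ?_
  by_cases hk : i = k
  · subst hk
    simp [pairPts_self hP]
  · exact pairPts_le_of_completes h hk

/-- Only eight matches have been played, so a team trailing one of the others by six points and
both remaining ones by at least seven has at most one point. -/
lemma AfterMD4.currentPts_le_one {P : Finset (Team × Team)} (hP : AfterMD4 P) {T : Tournament}
    {C D : Team} (hCD : C ≠ D) (hC : currentPts P T C = currentPts P T D + 6)
    (h : ∀ j : Team, j ≠ C → j ≠ D → currentPts P T D + 7 ≤ currentPts P T j) :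
    currentPts P T D ≤ 1 := by
  obtain ⟨E, A, B, hne, -, -, hDA, hDB, hEA, hEB⟩ := hP.exists_partner D
  have hsum : ∑ i, currentPts P T i ≤ 24 := by
    simp only [currentPts_eq_sum_pairPts hP.1, sum_team_eq hne, pairPts_self hP.1]
    have := pairPts_add_le P T D E
    have := pairPts_add_le P T A B
    have := pairPts_add_le_three T hDA
    have := pairPts_add_le_three T hDB
    have := pairPts_add_le_three T hEA
    have := pairPts_add_le_three T hEB
    omega
  have hlow : 4 * currentPts P T D + 20 ≤ ∑ i, currentPts P T i := by
    obtain ⟨A', B', hne'⟩ : ∃ A' B' : Team,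
        C ≠ D ∧ A' ≠ D ∧ B' ≠ D ∧ A' ≠ C ∧ B' ≠ C ∧ A' ≠ B' := by
      clear hC h hne hDA hDB hEA hEB hsum hP
      revert C D; decide
    have hA := h A' hne'.2.2.2.1 hne'.2.1
    have hB := h B' hne'.2.2.2.2.1 hne'.2.2.1
    rw [sum_team_eq hne']
    omega
  omega

lemma pairPts_le_currentPts {P : Finset (Team × Team)} (hP : ∀ m ∈ P, m.1 ≠ m.2)
    (T : Tournament) (i j : Team) : pairPts P T i j ≤ currentPts P T i := by
  rw [currentPts_eq_sum_pairPts hP]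
  exact Finset.single_le_sum (f := fun k => pairPts P T i k) (fun _ _ => Nat.zero_le _)
    (Finset.mem_univ j)

lemma mutualPts_lt_of_le_one {T : Tournament} {i j : Team} (h : mutualPts T i j ≤ 1) :
    mutualPts T i j < mutualPts T j i := by
  unfold mutualPts at *
  have h₁ := le_matchPts_of_matchPts_le_one (g := (T i j).1) (c := (T i j).2) (by omega)
  have h₂ := le_matchPts_of_matchPts_le_one (g := (T j i).2) (c := (T j i).1) (by omega)
  omega

/-- After Matchday 4, under the head-to-head tiebreak, team `D`
is certain to finish fourth iff (i) every other team leads it by at least 7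
points, or (ii) some team `C` leads it by exactly 6 points, every team other
than `C` and `D` leads it by at least 7 points, and `D` has already played both
matches against `C`. -/
theorem certainFourth_H2H_iff
    (P : Finset (Team × Team)) (T : Tournament) (hP : AfterMD4 P) (D : Team) :
    (∀ T' : Tournament, Completes P T T' → ∀ j : Team, j ≠ D → RankedAboveH2H T' j D) ↔
    ((∀ j : Team, j ≠ D → currentPts P T D + 7 ≤ currentPts P T j) ∨
      (∃ C : Team, C ≠ D ∧
        currentPts P T C = currentPts P T D + 6 ∧
        (∀ j : Team, j ≠ C → j ≠ D → currentPts P T D + 7 ≤ currentPts P T j) ∧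
        (C, D) ∈ P ∧ (D, C) ∈ P)) := by
  have hle := fun T' h => hP.totalPts_le (T := T) (T' := T') h D
  have hge := fun T' h j => currentPts_le_totalPts hP.1 (T := T) (T' := T') h j
  constructor
  · intro h
    have hlead := fun j hj => hP.lead_of_certain (T := T) hj fun T' hT' => h T' hT' j hj
    by_cases hall : ∀ j : Team, j ≠ D → currentPts P T D + 7 ≤ currentPts P T j
    · exact .inl hall
    · push Not at hall
      obtain ⟨C, hC, hlt⟩ := hall
      obtain ⟨hC6, hCD, hDC⟩ := (hlead C hC).resolve_left (by omega)
      refine .inr ⟨C, hC, hC6, fun j hjC hjD => (hlead j hjD).resolve_right ?_, hCD, hDC⟩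
      rintro ⟨-, hjD', hDj⟩
      obtain ⟨E, A, B, hne, -, -, hA, hB, -⟩ := hP.exists_partner D
      have hcover : ∀ k : Team, k ≠ D → k = E ∨ k = A ∨ k = B := by
        clear * - hne
        revert D E A B; decide
      have hE : ∀ k : Team, k ≠ D → (k, D) ∈ P → (D, k) ∈ P → k = E := by
        intro k hk h₁ h₂
        rcases hcover k hk with rfl | rfl | rfl
        · rfl
        · exact absurd ⟨h₂, h₁⟩ hA
        · exact absurd ⟨h₂, h₁⟩ hB
      exact hjC ((hE j hjD hjD' hDj).trans (hE C hC hCD hDC).symm)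
  · rintro (h | ⟨C, hC, hC6, hrest, hCD, hDC⟩) T' hT' j hj
    · have := h j hj
      have := hle T' hT'
      have := hge T' hT' j
      exact .inl (by omega)
    · have h₁ := hle T' hT'
      have h₂ := hge T' hT' j
      by_cases hjC : j = C
      · subst hjC
        rcases (h₁.trans (hC6.ge.trans h₂)).lt_or_eq with h₃ | h₃
        · exact .inl h₃
        · refine .inr (.inl ⟨h₃.symm, mutualPts_lt_of_le_one ?_⟩)
          have e₁ := hT' _ hCD
          have e₂ := hT' _ hDC
          have e : mutualPts T' D j = mutualPts T D j := by
            simp only [mutualPts] at *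
            rw [e₁, e₂]
          rw [e, mutualPts_eq_pairPts hDC hCD]
          exact (pairPts_le_currentPts hP.1 T D j).trans (hP.currentPts_le_one hC hC6 hrest)
      · have := hrest j hjC hj
        exact .inl (by omega)
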